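/- Let n ≥ 10 and let (P, 𝓑) be a pairwise balanced design on n points in which every block B satisfies |B| ≤ n − (√n + 1)/2 (as real numbers). Then Σ_{B ∈ 𝓑} |B| ≥ n(⌊√n⌋ + 1) − 1. -/

import Mathlib

/-- A pairwise balanced design (PBD): `B` is a family of subsets of `P`, each of
size at least `2`, such that every pair of distinct points of `P` is contained
in exactly one block. -/
def IsPBD {α : Type*} [DecidableEq α] (P : Finset α) (B : Finset (Finset α)) : Prop :=
  (∀ b ∈ B, b ⊆ P ∧ 2 ≤ b.card) ∧
    ∀ x ∈ P, ∀ y ∈ P, x ≠ y → ∃! b, b ∈ B ∧ x ∈ b ∧ y ∈ b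

/-- A PBD is nontrivial if no block equals the whole point set. -/
def IsNontrivialPBD {α : Type*} [DecidableEq α] (P : Finset α) (B : Finset (Finset α)) : Prop :=
  IsPBD P B ∧ ∀ b ∈ B, b ≠ P

/-- Each pair of distinct points lies in exactly one block, so the pairs of `D` may be counted
block by block. -/
lemma IsPBD.sum_card_filter_mem {α : Type*} [DecidableEq α] {P : Finset α}
    {B : Finset (Finset α)} (h : IsPBD P B) {D : Finset (α × α)} (hD : D ⊆ P.offDiag) :
    ∑ b ∈ B, (D.filter fun p => p.1 ∈ b ∧ p.2 ∈ b).card = D.card := by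
  simp_rw [Finset.card_filter]
  rw [Finset.sum_comm, Finset.card_eq_sum_ones]
  refine Finset.sum_congr rfl fun p hp => ?_
  obtain ⟨hx, hy, hxy⟩ := Finset.mem_offDiag.1 (hD hp)
  obtain ⟨b, hb, huniq⟩ := h.2 _ hx _ hy hxy
  rw [← Finset.card_filter, Finset.card_eq_one]
  refine ⟨b, Finset.ext fun c => ?_⟩
  rw [Finset.mem_filter, Finset.mem_singleton]
  exact ⟨fun hc => huniq c hc, fun hc => hc ▸ hb⟩

lemma IsPBD.sum_card_inter_mul_card_inter {α : Type*} [DecidableEq α] {P : Finset α}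
    {B : Finset (Finset α)} (h : IsPBD P B) {X Y : Finset α} (hX : X ⊆ P) (hY : Y ⊆ P)
    (hXY : Disjoint X Y) :
    ∑ b ∈ B, (b ∩ X).card * (b ∩ Y).card = X.card * Y.card := by
  rw [← Finset.card_product, ← h.sum_card_filter_mem (D := X ×ˢ Y)]
  · refine Finset.sum_congr rfl fun b _ => ?_
    rw [← Finset.card_product]
    congr 1
    ext p
    simp only [Finset.mem_product, Finset.mem_inter, Finset.mem_filter]
    tauto
  · intro p hp
    obtain ⟨h1, h2⟩ := Finset.mem_product.1 hp
    exact Finset.mem_offDiag.2 ⟨hX h1, hY h2, fun e => Finset.disjoint_left.1 hXY h1 (e ▸ h2)⟩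

lemma IsPBD.sum_card_offDiag_inter {α : Type*} [DecidableEq α] {P : Finset α}
    {B : Finset (Finset α)} (h : IsPBD P B) {X : Finset α} (hX : X ⊆ P) :
    ∑ b ∈ B, (b ∩ X).offDiag.card = X.offDiag.card := by
  rw [← h.sum_card_filter_mem (Finset.offDiag_mono hX)]
  refine Finset.sum_congr rfl fun b _ => ?_
  congr 1
  ext p
  simp only [Finset.mem_offDiag, Finset.mem_inter, Finset.mem_filter]
  tauto

lemma IsPBD.card_inter_le_one {α : Type*} [DecidableEq α] {P : Finset α}
    {B : Finset (Finset α)} (h : IsPBD P B) {b c : Finset α} (hb : b ∈ B) (hc : c ∈ B)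
    (hbc : b ≠ c) : (b ∩ c).card ≤ 1 := by
  refine Finset.card_le_one.2 fun x hx y hy => ?_
  by_contra hxy
  rw [Finset.mem_inter] at hx hy
  exact hbc ((h.2 x ((h.1 b hb).1 hx.1) y ((h.1 b hb).1 hy.1) hxy).unique
    ⟨hb, hx.1, hy.1⟩ ⟨hc, hx.2, hy.2⟩)

/-- If no block has more than `q` points, then `∑ |b| ≥ n (n - 1) / (q - 1)`. -/
lemma IsPBD.card_mul_pred_le_of_card_le {α : Type*} [DecidableEq α] {P : Finset α}
    {B : Finset (Finset α)} (h : IsPBD P B) {q : ℕ} (hq : ∀ b ∈ B, b.card ≤ q) :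
    P.card * (P.card - 1) ≤ (∑ b ∈ B, b.card) * (q - 1) := by
  have key := h.sum_card_offDiag_inter (Finset.Subset.refl P)
  rw [Finset.offDiag_card, ← Nat.mul_sub_one] at key
  rw [← key, Finset.sum_mul]
  refine Finset.sum_le_sum fun b hb => ?_
  rw [Finset.inter_eq_left.2 (h.1 b hb).1, Finset.offDiag_card, ← Nat.mul_sub_one]
  exact Nat.mul_le_mul_left _ (Nat.sub_le_sub_right (hq b hb) 1)

/-- A block `L` of size `k` forces `∑ |b| ≥ k + c + k (n - k)`, where `c`, the number of other
blocks meeting `L`, satisfies `c (n - 1) ≥ k² (n - k)` by Cauchy-Schwarz. -/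
lemma IsPBD.exists_le_sum_card {α : Type*} [DecidableEq α] {P : Finset α}
    {B : Finset (Finset α)} (h : IsPBD P B) {L : Finset α} (hL : L ∈ B)
    (hLP : L.card < P.card) :
    ∃ c : ℕ, L.card + c + L.card * (P.card - L.card) ≤ ∑ b ∈ B, b.card ∧
      L.card ^ 2 * (P.card - L.card) ≤ c * (P.card - 1) := by
  have hLsub : L ⊆ P := (h.1 L hL).1
  have hVcard : (P \ L).card = P.card - L.card := Finset.card_sdiff_of_subset hLsub
  rw [← hVcard]
  set V := P \ L with hV
  have hLV : L ∩ V = ∅ := by simp [hV]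
  have hVP : V ⊆ P := Finset.sdiff_subset
  have hcross : ∑ b ∈ B.erase L, (b ∩ L).card * (b ∩ V).card = L.card * V.card := by
    have := h.sum_card_inter_mul_card_inter hLsub hVP Finset.disjoint_sdiff
    rw [← Finset.add_sum_erase _ _ hL, hLV] at this
    simpa using this
  have houter : ∑ b ∈ B.erase L, (b ∩ V).offDiag.card = V.card * V.card - V.card := by
    have := h.sum_card_offDiag_inter hVP
    rw [← Finset.add_sum_erase _ _ hL, hLV, Finset.offDiag_card V] at this
    simpa using this
  have hle : ∀ b ∈ B.erase L, (b ∩ L).card ≤ 1 := fun b hb =>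
    h.card_inter_le_one (Finset.mem_of_mem_erase hb) hL (Finset.ne_of_mem_erase hb)
  refine ⟨∑ b ∈ B.erase L, (b ∩ L).card, ?_, ?_⟩
  · rw [← Finset.add_sum_erase _ _ hL, ← hcross, add_assoc, ← Finset.sum_add_distrib]
    refine Nat.add_le_add_left (Finset.sum_le_sum fun b hb => ?_) _
    have hbP : b ⊆ P := (h.1 b (Finset.mem_of_mem_erase hb)).1
    have hsplit : (b ∩ L).card + (b ∩ V).card = b.card := by
      rw [← Finset.card_inter_add_card_sdiff b L]
      congr 2
      ext x
      have := @hbP x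
      simp only [hV, Finset.mem_inter, Finset.mem_sdiff]
      tauto
    nlinarith [hle b hb]
  · have hcs := Finset.sum_mul_sq_le_sq_mul_sq (B.erase L) (fun b => (b ∩ L).card)
      (fun b => (b ∩ L).card * (b ∩ V).card)
    have hidem : ∀ b ∈ B.erase L, (b ∩ L).card ^ 2 = (b ∩ L).card := fun b hb => by
      have := hle b hb
      interval_cases (b ∩ L).card <;> rfl
    have hsum : ∑ b ∈ B.erase L, (b ∩ L).card * ((b ∩ L).card * (b ∩ V).card) =
        L.card * V.card := by
      rw [← hcross]
      refine Finset.sum_congr rfl fun b hb => ?_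
      rw [← mul_assoc, ← sq, hidem b hb]
    have hsq : ∑ b ∈ B.erase L, ((b ∩ L).card * (b ∩ V).card) ^ 2 ≤
        L.card * V.card + (V.card * V.card - V.card) := by
      rw [← hcross, ← houter, ← Finset.sum_add_distrib]
      refine Finset.sum_le_sum fun b hb => ?_
      rw [mul_pow, hidem b hb, Finset.offDiag_card]
      have h1 := hle b hb
      have h2 : (b ∩ V).card ≤ (b ∩ V).card * (b ∩ V).card := Nat.le_mul_self _
      rw [sq]
      interval_cases (b ∩ L).card <;> omega
    rw [hsum, Finset.sum_congr rfl hidem] at hcs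
    have hcs' := hcs.trans (Nat.mul_le_mul_left _ hsq)
    have hVpos : 0 < V.card := by omega
    have hfac : L.card * V.card + (V.card * V.card - V.card) = (P.card - 1) * V.card := by
      have h2 : V.card ≤ V.card * V.card := Nat.le_mul_self _
      have h3 : P.card = L.card + V.card := by omega
      have h4 : 1 ≤ L.card + V.card := by omega
      rw [h3]
      zify [h2, h4]
      ring
    rw [hfac] at hcs'
    refine Nat.le_of_mul_le_mul_right ?_ hVpos
    calc L.card ^ 2 * V.card * V.card = (L.card * V.card) ^ 2 := by ring
      _ ≤ _ := hcs'
      _ = _ := by ring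

/-- The cubic `x (m + x - x ^ 2)` is concave on `x ≥ 1`, so it exceeds `G` between two points
where it does. -/
lemma lt_cubic_of_mem_Icc {m G a b x : ℝ} (ha : 1 ≤ a) (hax : a ≤ x) (hxb : x ≤ b)
    (hGa : G < a * (m + a - a ^ 2)) (hGb : G < b * (m + b - b ^ 2)) :
    G < x * (m + x - x ^ 2) := by
  rcases hax.eq_or_lt with rfl | hax'
  · exact hGa
  have hab : 0 < b - a := by linarith
  have hchord : (b - a) * (x * (m + x - x ^ 2)) = (b - x) * (a * (m + a - a ^ 2)) +
      (x - a) * (b * (m + b - b ^ 2)) + (b - x) * (x - a) * (b - a) * (x + a + b - 1) := by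
    ring
  have h1 : 0 ≤ (b - x) * (x - a) * (b - a) * (x + a + b - 1) := by
    have : 0 ≤ b - x := by linarith
    have : 0 ≤ x - a := by linarith
    have : 0 ≤ x + a + b - 1 := by linarith
    positivity
  have h2 : (b - x) * G ≤ (b - x) * (a * (m + a - a ^ 2)) :=
    mul_le_mul_of_nonneg_left hGa.le (by linarith)
  have h3 : (x - a) * G < (x - a) * (b * (m + b - b ^ 2)) :=
    mul_lt_mul_of_pos_left hGb (by linarith)
  refine lt_of_mul_lt_mul_left ?_ hab.le
  rw [hchord]
  linarith

lemma lt_cubic_sqrt_add_one {n : ℕ} (hn : 10 ≤ n) :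
    ((n : ℝ) - 1) * (n * (Nat.sqrt n + 1) - 2) <
      (Nat.sqrt n + 1) * ((n : ℝ) ^ 2 - 1 + (Nat.sqrt n + 1) - (Nat.sqrt n + 1) ^ 2) := by
  have hq3 : 3 ≤ Nat.sqrt n := Nat.le_sqrt.2 (by omega)
  have hqn : Nat.sqrt n ^ 2 ≤ n := Nat.sqrt_le' n
  generalize Nat.sqrt n = q at *
  have key : (q : ℝ) * (q + 1) ^ 2 < (q + 3) * (n - 1) := by
    rcases hq3.eq_or_lt with rfl | h4
    · have : (10 : ℝ) ≤ n := by exact_mod_cast hn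
      push_cast
      linarith
    · have h4' : (4 : ℝ) ≤ q := by exact_mod_cast h4
      have hqn' : (q : ℝ) ^ 2 ≤ n := by exact_mod_cast hqn
      nlinarith
  linarith

lemma lt_cubic_sub_half_sqrt_add_one {n : ℕ} (hn : 21 ≤ n) :
    ((n : ℝ) - 1) * (n * (Nat.sqrt n + 1) - 2) <
      (n - (√n + 1) / 2) * ((n : ℝ) ^ 2 - 1 + (n - (√n + 1) / 2) - (n - (√n + 1) / 2) ^ 2) := by
  have hqt : (Nat.sqrt n : ℝ) ≤ √n := Real.nat_sqrt_le_real_sqrt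
  have hn' : (21 : ℝ) ≤ n := by exact_mod_cast hn
  have ht : (9 / 2 : ℝ) < √n := Real.lt_sqrt_of_sq_lt (by linarith)
  have hsq : (n : ℝ) = √n ^ 2 := (Real.sq_sqrt (by linarith)).symm
  generalize √(n : ℝ) = t at *
  have hmono : ((n : ℝ) - 1) * (n * (Nat.sqrt n + 1) - 2) ≤ (n - 1) * (n * (t + 1) - 2) := by
    gcongr
    linarith
  refine hmono.trans_lt ?_
  rw [hsq, ← sub_pos]
  have : 0 < (t ^ 2 - 1) * ((2 * t - 9) * (t - 1)) / 8 := by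
    have : 0 < t ^ 2 - 1 := by nlinarith
    have : 0 < 2 * t - 9 := by linarith
    have : 0 < t - 1 := by linarith
    positivity
  linarith

lemma lt_cubic_sub_three {n : ℕ} (hn : 10 ≤ n) (hn' : n ≤ 20) :
    ((n : ℝ) - 1) * (n * (Nat.sqrt n + 1) - 2) <
      (n - 3) * ((n : ℝ) ^ 2 - 1 + (n - 3) - (n - 3) ^ 2) := by
  have h1 : (10 : ℝ) ≤ n := by exact_mod_cast hn
  have h2 : (n : ℝ) ≤ 20 := by exact_mod_cast hn'
  have hq : (Nat.sqrt n : ℝ) ≤ 3 ∨ (Nat.sqrt n : ℝ) ≤ 4 ∧ (16 : ℝ) ≤ n := by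
    have h5 : Nat.sqrt n < 5 := Nat.sqrt_lt.2 (by omega)
    have h4 : 4 ≤ Nat.sqrt n ↔ 4 * 4 ≤ n := Nat.le_sqrt
    have : Nat.sqrt n ≤ 3 ∨ Nat.sqrt n ≤ 4 ∧ 16 ≤ n := by omega
    exact_mod_cast this
  have hmono : ∀ r : ℝ, Nat.sqrt n ≤ r →
      ((n : ℝ) - 1) * (n * (Nat.sqrt n + 1) - 2) ≤ (n - 1) * (n * (r + 1) - 2) := fun r hr => by
    gcongr
    linarith
  rcases hq with hq | ⟨hq, h16⟩
  · exact (hmono 3 hq).trans_lt (by nlinarith)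
  · exact (hmono 4 hq).trans_lt (by nlinarith)

lemma lt_cubic_of_sqrt_lt {n k : ℕ} (hn : 10 ≤ n) (hk : Nat.sqrt n + 1 ≤ k)
    (hk' : (k : ℝ) ≤ n - (√n + 1) / 2) :
    ((n : ℝ) - 1) * (n * (Nat.sqrt n + 1) - 2) < k * ((n : ℝ) ^ 2 - 1 + k - k ^ 2) := by
  have ha : (1 : ℝ) ≤ (Nat.sqrt n : ℝ) + 1 := le_add_of_nonneg_left (Nat.cast_nonneg _)
  have hak : (Nat.sqrt n : ℝ) + 1 ≤ k := by exact_mod_cast hk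
  rcases Nat.lt_or_ge 20 n with h21 | h20
  · exact lt_cubic_of_mem_Icc ha hak hk' (lt_cubic_sqrt_add_one hn)
      (lt_cubic_sub_half_sqrt_add_one h21)
  · refine lt_cubic_of_mem_Icc ha hak ?_ (lt_cubic_sqrt_add_one hn) (lt_cubic_sub_three hn h20)
    have h10 : (10 : ℝ) ≤ n := by exact_mod_cast hn
    have ht : (3 : ℝ) < √n := Real.lt_sqrt_of_sq_lt (by linarith)
    have hlt : (k : ℝ) + 2 < n := by linarith
    have : k + 2 < n := by exact_mod_cast hlt
    have : ((k + 3 : ℕ) : ℝ) ≤ n := by exact_mod_cast this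
    push_cast at this
    linarith

theorem pbd_sum_ge_of_no_large_block {α : Type*} [DecidableEq α] (n : ℕ) (hn : 10 ≤ n)
    (P : Finset α) (B : Finset (Finset α)) (hP : P.card = n)
    (h : IsPBD P B)
    (hsize : ∀ b ∈ B, (b.card : ℝ) ≤ n - (Real.sqrt n + 1) / 2) :
    n * (Nat.sqrt n + 1) - 1 ≤ ∑ b ∈ B, b.card := by
  by_cases hsmall : ∀ b ∈ B, b.card ≤ Nat.sqrt n
  · have hS := h.card_mul_pred_le_of_card_le hsmall
    rw [hP] at hS
    have hq3 : 3 ≤ Nat.sqrt n := Nat.le_sqrt.2 (by omega)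
    have hqn : Nat.sqrt n ^ 2 ≤ n := Nat.sqrt_le' n
    refine (Nat.sub_le _ 1).trans (Nat.le_of_mul_le_mul_right (le_trans ?_ hS)
      (show 0 < Nat.sqrt n - 1 by omega))
    rw [mul_assoc]
    refine Nat.mul_le_mul_left _ ?_
    rw [← Nat.sq_sub_sq, one_pow]
    exact Nat.sub_le_sub_right hqn 1
  · push Not at hsmall
    obtain ⟨L, hL, hLq⟩ := hsmall
    have hlt := lt_cubic_of_sqrt_lt hn hLq (hsize L hL)
    have hLn : L.card < n := by
      have := hsize L hL
      have := Real.sqrt_nonneg (n : ℝ)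
      exact_mod_cast (by linarith : (L.card : ℝ) < n)
    obtain ⟨c, hc, hcn⟩ := h.exists_le_sum_card hL (hP ▸ hLn)
    rw [hP] at hc hcn
    by_contra! hcon
    have hbound : L.card + c + L.card * (n - L.card) + 2 ≤ n * (Nat.sqrt n + 1) := by omega
    have hbound' : (L.card : ℝ) + c + L.card * (n - L.card) + 2 ≤ n * (Nat.sqrt n + 1) := by
      rw [← Nat.cast_sub hLn.le]
      exact_mod_cast hbound
    have hcn' : (L.card : ℝ) ^ 2 * (n - L.card) ≤ c * (n - 1) := by
      rw [← Nat.cast_sub hLn.le, ← Nat.cast_one, ← Nat.cast_sub (by omega : 1 ≤ n)]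
      exact_mod_cast hcn
    have hn1 : (0 : ℝ) ≤ n - 1 := by
      have : (10 : ℝ) ≤ n := by exact_mod_cast hn
      linarith
    have := mul_le_mul_of_nonneg_left hbound' hn1
    linarith
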